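/- In the single-product Fixed-case lot-sizing model, every feasible cyclic schedule has average holding cost per time unit at least (h/2)·(p − gcd(p,d)): for every initial stock q0 ≥ 0, production pattern x : ℕ → Bool and positive integer l such that q t ≥ 0 for all t ≤ l and q l = q 0, one has 2 · ∑_{t=0}^{l−1} q t ≥ l · (p − gcd(p,d)). -/

import Mathlib

/-- The stock at time `t` is determined modulo `p` by the initial stock. -/
theorem dvd_stock_sub (p d : ℕ) (x : ℕ → Bool) (q : ℕ → ℤ)
    (hrec : ∀ t, q (t + 1) = q t + (if x t then (p : ℤ) else 0) - d) (t : ℕ) :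
    (p : ℤ) ∣ q t - (q 0 - t * d) := by
  induction t with
  | zero => simp
  | succ t ih =>
    have h : (p : ℤ) ∣ (if x t then (p : ℤ) else 0) := by split_ifs <;> simp
    have e : q (t + 1) - (q 0 - ((t + 1 : ℕ) : ℤ) * d) =
        q t - (q 0 - t * d) + (if x t then (p : ℤ) else 0) := by
      rw [hrec]; push_cast; ring
    rw [e]
    exact dvd_add ih h

/-- If `u` and `v` are nonnegative integers, `u` is congruent to `r` modulo `g` with `0 ≤ r < g`,
and `u + v` is congruent to `2 * r - g` modulo `p`, then `u + v` is at least `p - g`. -/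
theorem sub_le_add_of_dvd {p g r u v : ℤ} (hr : 0 ≤ r) (hrg : r < g)
    (hu : 0 ≤ u) (hv : 0 ≤ v) (hur : g ∣ u - r)
    (huv : p ∣ u + v - (2 * r - g)) : p - g ≤ u + v := by
  have hru : r ≤ u := by
    obtain ⟨k, hk⟩ := hur
    have : 0 ≤ k := by
      by_contra! h
      nlinarith
    nlinarith
  have h := Int.le_of_dvd (by linarith) huv
  linarith

/-- Single-product Fixed-case lot-sizing: every feasible cyclic schedule has average
holding cost per time unit at least `h/2 * (p - gcd p d)`, i.e.
`2 * ∑_{t<l} q t ≥ l * (p - gcd p d)`. -/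
theorem stmt_6 (p d : ℕ) (hd : 0 < d) (hdp : d ≤ p)
    (q0 : ℤ) (hq0nonneg : 0 ≤ q0) (x : ℕ → Bool) (q : ℕ → ℤ)
    (hq0 : q 0 = q0)
    (hrec : ∀ t, q (t + 1) = q t + (if x t then (p : ℤ) else 0) - d)
    (l : ℕ) (hl : 0 < l)
    (hfeas : ∀ t ≤ l, 0 ≤ q t) (hcyc : q l = q 0) :
    2 * ∑ t ∈ Finset.range l, q t ≥ (l : ℤ) * ((p : ℤ) - (Nat.gcd p d : ℤ)) := by
  have hp : 0 < p := hd.trans_le hdp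
  obtain ⟨n, rfl⟩ : ∃ n, l = n + 1 := ⟨l - 1, by omega⟩
  set g : ℤ := (Nat.gcd p d : ℤ)
  have hgpos : 0 < g := Int.natCast_pos.mpr (Nat.gcd_pos_of_pos_left d hp)
  have hgp : g ∣ p := Int.natCast_dvd_natCast.mpr (Nat.gcd_dvd_left p d)
  have hgd : g ∣ d := Int.natCast_dvd_natCast.mpr (Nat.gcd_dvd_right p d)
  have hmod := dvd_stock_sub p d x q hrec
  have hld : (p : ℤ) ∣ ((n + 1 : ℕ) : ℤ) * d := by
    simpa [hcyc] using hmod (n + 1)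
  set r := q 0 % g
  have hqr : ∀ t, g ∣ q t - r := fun t => by
    have h1 := (hgp.trans (hmod t)).sub (hgd.mul_left (t : ℤ))
    have h2 : g ∣ q 0 - r := Int.dvd_self_sub_emod
    exact (by ring : q t - (q 0 - t * d) - t * d + (q 0 - r) = q t - r) ▸ h1.add h2
  obtain ⟨c, hc⟩ : ∃ c : ℤ, (p : ℤ) ∣ c * d - (2 * (q 0 - r) + g) := by
    obtain ⟨k, hk⟩ := hqr 0
    have hb : g = p * Nat.gcdA p d + d * Nat.gcdB p d := Nat.gcd_eq_gcd_ab p d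
    refine ⟨Nat.gcdB p d * (2 * k + 1), -(Nat.gcdA p d * (2 * k + 1)), ?_⟩
    rw [hk]
    linear_combination -(2 * k + 1) * hb
  have hsum : ∑ t ∈ Finset.range (n + 1), q t = ∑ a : ZMod (n + 1), q a.val :=
    Finset.sum_range q
  have hrefl : ∑ a : ZMod (n + 1), q ((c : ZMod (n + 1)) - a).val = ∑ a : ZMod (n + 1), q a.val :=
    Equiv.sum_comp (Equiv.subLeft (c : ZMod (n + 1))) fun a => q a.val
  have hpair : ∀ a : ZMod (n + 1),
      (p : ℤ) - g ≤ q a.val + q ((c : ZMod (n + 1)) - a).val := by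
    intro a
    set b := (c : ZMod (n + 1)) - a with hb
    have hab : ((n + 1 : ℕ) : ℤ) ∣ c - (a.val + b.val) := by
      rw [← ZMod.intCast_zmod_eq_zero_iff_dvd]
      simp [hb]
    refine sub_le_add_of_dvd (Int.emod_nonneg _ hgpos.ne')
      (Int.emod_lt_of_pos _ hgpos) (hfeas _ a.val_lt.le) (hfeas _ b.val_lt.le)
      (hqr _) ?_
    have h := (((hmod a.val).add (hmod b.val)).add (hld.trans (mul_dvd_mul_right hab (d : ℤ)))).sub
      hc
    have e : q a.val - (q 0 - a.val * d) + (q b.val - (q 0 - b.val * d)) +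
        (c - (a.val + b.val)) * d - (c * d - (2 * (q 0 - r) + g)) =
        q a.val + q b.val - (2 * r - g) := by ring
    exact e ▸ h
  have hle := Finset.sum_le_sum fun a (_ : a ∈ Finset.univ) => hpair a
  rw [Finset.sum_add_distrib, hrefl, ← hsum] at hle
  simp only [Finset.sum_const, Finset.card_univ, ZMod.card, nsmul_eq_mul] at hle
  linarith
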